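/- arXiv:1004.4195 — 3 statements merged into one kernel-verified Lean document; each statement's English description precedes it below -/
import Mathlib

section
/- Fix integers g ≥ 2, p ≥ 0 and n ∈ ℤ, and let Ã, H̃ : ℤ_{≥1} × ℤ → ℚ(y) be arbitrary functions with Ã(1,e) = 0 for all e < 0. For γ = (2,2n) (so γ̃ = (2, 4g−4−2n)), define R(γ) := Ã(γ) − Ã(γ̃) + Σ_{l≥2} ((−1)^{l−1}/(l−1)!) Σ_{γ_1+⋯+γ_l=γ, μ_0(2)≤μ(γ)<μ(γ_i) for 2≤i≤l, μ_0(2)≤μ(γ_1)} Ã(γ_1) ∏_{i=2}^{l} [e_i−r_i(g−1)]_y H̃(γ_i) − Σ_{l≥2} ((−1)^{l−1}/(l−1)!) Σ_{γ_1+⋯+γ_l=γ̃, μ_0(2)≤μ(γ̃)≤μ(γ_i) for 2≤i≤l, μ_0(2)≤μ(γ_1)} Ã(γ_1) ∏_{i=2}^{l} [e_i−r_i(g−1)]_y H̃(γ_i) − Σ_{l≥2} (1/l!) Σ_{γ_1+⋯+γ_l=γ, μ(γ_i)=μ(γ) ∀i} ∏_{i=1}^{l} [e_i−r_i(g−1)]_y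 H̃(γ_i), with γ_i = (r_i, e_i). Then R(γ) = Ã(2,2n) − Ã(2,4g−4−2n) − Σ_{e_1=0}^{n−1} Ã(1,e_1)·[2n−e_1−g+1]_y·H̃(1,2n−e_1) + Σ_{e_1=0}^{2g−2−n} Ã(1,e_1)·[3g−3−2n−e_1]_y·H̃(1,4g−4−2n−e_1) − (1/2)·[n−g+1]_y²·H̃(1,n)². -/
open scoped Classical

noncomputable section

/-- `γ̃ = (r, -e + 2r(g-1))`. -/
def tilde (g : ℤ) (γ : ℤ × ℤ) : ℤ × ℤ := (γ.1, -γ.2 + 2 * γ.1 * (g - 1))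

/-- The slope `μ(r,e) = e/r ∈ ℚ`. -/
def slopeZ (γ : ℤ × ℤ) : ℚ := (γ.2 : ℚ) / (γ.1 : ℚ)

/-- `μ₀(r) = -(r-1)(2g-2+p)`. -/
def mu0 (g p r : ℤ) : ℚ := ((-(r - 1) * (2 * g - 2 + p) : ℤ) : ℚ)

/-- `[m]_y = (y^m - y^{-m})/(y - y⁻¹) ∈ ℚ(y)`. -/
def brk (m : ℤ) : RatFunc ℚ :=
  ((RatFunc.X : RatFunc ℚ) ^ m - (RatFunc.X : RatFunc ℚ) ^ (-m)) /
    (RatFunc.X - (RatFunc.X : RatFunc ℚ)⁻¹)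

/-- `[e - r(g-1)]_y` for `γ = (r,e)`. -/
def wgt (g : ℤ) (γ : ℤ × ℤ) : RatFunc ℚ := brk (γ.2 - γ.1 * (g - 1))

/-- The right hand side `R(γ)` of the recursion \eqref{eq:higgsrecursionC}:
`R(γ) = Ã(γ) - Ã(γ̃)`
`+ Σ_{l≥2} ((-1)^{l-1}/(l-1)!) Σ_{γ₁+⋯+γ_l=γ, μ₀(r)≤μ(γ)<μ(γ_i) (i≥2), μ₀(r)≤μ(γ₁)} Ã(γ₁)∏_{i≥2}[e_i-r_i(g-1)]H̃(γ_i)`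
`- Σ_{l≥2} ((-1)^{l-1}/(l-1)!) Σ_{γ₁+⋯+γ_l=γ̃, μ₀(r)≤μ(γ̃)≤μ(γ_i) (i≥2), μ₀(r)≤μ(γ₁)} Ã(γ₁)∏_{i≥2}[e_i-r_i(g-1)]H̃(γ_i)`
`- Σ_{l≥2} (1/l!) Σ_{γ₁+⋯+γ_l=γ, μ(γ_i)=μ(γ) ∀i} ∏_i [e_i-r_i(g-1)]H̃(γ_i)`,
where an ordered tuple `(γ₁,…,γ_l)` with `l ≥ 2` is encoded as the pair
`t = (γ₁, [γ₂,…,γ_l])` (a nonempty list) in the first two sums, and as a list of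
length `≥ 2` in the last one. -/
def Rrec (g p : ℤ) (At Ht : ℤ × ℤ → RatFunc ℚ) (γ : ℤ × ℤ) : RatFunc ℚ :=
  At γ - At (tilde g γ)
  + (∑ᶠ t : (ℤ × ℤ) × List (ℤ × ℤ),
      if t.2 ≠ [] ∧ 1 ≤ t.1.1 ∧ (∀ x ∈ t.2, 1 ≤ x.1) ∧ t.1 + t.2.sum = γ ∧
          mu0 g p γ.1 ≤ slopeZ γ ∧ (∀ x ∈ t.2, slopeZ γ < slopeZ x) ∧
          mu0 g p γ.1 ≤ slopeZ t.1 then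
        RatFunc.C ((-1 : ℚ) ^ t.2.length / (Nat.factorial t.2.length : ℚ)) *
          At t.1 * (t.2.map (fun x => wgt g x * Ht x)).prod
      else 0)
  - (∑ᶠ t : (ℤ × ℤ) × List (ℤ × ℤ),
      if t.2 ≠ [] ∧ 1 ≤ t.1.1 ∧ (∀ x ∈ t.2, 1 ≤ x.1) ∧ t.1 + t.2.sum = tilde g γ ∧
          mu0 g p γ.1 ≤ slopeZ (tilde g γ) ∧
          (∀ x ∈ t.2, slopeZ (tilde g γ) ≤ slopeZ x) ∧
          mu0 g p γ.1 ≤ slopeZ t.1 then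
        RatFunc.C ((-1 : ℚ) ^ t.2.length / (Nat.factorial t.2.length : ℚ)) *
          At t.1 * (t.2.map (fun x => wgt g x * Ht x)).prod
      else 0)
  - (∑ᶠ L : List (ℤ × ℤ),
      if 2 ≤ L.length ∧ (∀ x ∈ L, 1 ≤ x.1) ∧ L.sum = γ ∧
          (∀ x ∈ L, slopeZ x = slopeZ γ) then
        RatFunc.C (1 / (Nat.factorial L.length : ℚ)) *
          (L.map (fun x => wgt g x * Ht x)).prod
      else 0)

/-- A list of pairs with positive first entries has a sum of first entry at least its length. -/
theorem length_le_fst_sum (L : List (ℤ × ℤ)) (h : ∀ x ∈ L, 1 ≤ x.1) :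
    (L.length : ℤ) ≤ L.sum.1 := by
  induction L with
  | nil => simp
  | cons a L ih =>
    have := ih fun x hx => h x (List.mem_cons_of_mem _ hx)
    have := h a List.mem_cons_self
    simp only [List.length_cons, List.sum_cons, Prod.fst_add]
    push_cast
    linarith

/-- Decompositions of a rank-two class with at least two parts have exactly two rank-one parts. -/
theorem rank_two_decomposition {m : ℤ} {t : (ℤ × ℤ) × List (ℤ × ℤ)} (hne : t.2 ≠ [])
    (h1 : 1 ≤ t.1.1) (h : ∀ x ∈ t.2, 1 ≤ x.1) (hs : t.1 + t.2.sum = (2, m)) :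
    ∃ e : ℤ, t = ((1, e), [(1, m - e)]) := by
  obtain ⟨⟨r, e⟩, L⟩ := t
  match L, hne with
  | [(r', e')], _ =>
    simp only [List.mem_singleton, forall_eq, List.sum_singleton, Prod.mk_add_mk,
      Prod.mk.injEq] at h1 h hs
    refine ⟨e, ?_⟩
    simp only [Prod.mk.injEq, List.cons.injEq, and_true]
    omega
  | a :: b :: L, _ =>
    have hl := length_le_fst_sum _ h
    have := congrArg Prod.fst hs
    simp only [Prod.fst_add, List.length_cons] at this hl h1
    push_cast at hl
    omega

theorem finsum_eq_sum_range_rank_two {M : Type*} [AddCommMonoid M]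
    (F : (ℤ × ℤ) × List (ℤ × ℤ) → M) (m : ℤ) (N : ℕ)
    (hF : ∀ t, F t ≠ 0 → ∃ k < N, t = ((1, (k : ℤ)), [(1, m - k)])) :
    ∑ᶠ t, F t = ∑ k ∈ Finset.range N, F ((1, (k : ℤ)), [(1, m - k)]) := by
  rw [finsum_eq_sum_of_support_subset F
    (s := (Finset.range N).image fun k : ℕ => ((1, (k : ℤ)), [(1, m - (k : ℤ))])),
    Finset.sum_image]
  · intro a _ b _ hab
    simpa using congrArg (fun t => t.1.2) hab
  · intro t ht
    obtain ⟨k, hk, rfl⟩ := hF t ht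
    simp only [Finset.coe_image, Set.mem_image, Finset.coe_range, Set.mem_Iio]
    exact ⟨k, hk, rfl⟩

theorem slopeZ_one (e : ℤ) : slopeZ (1, e) = e := by simp [slopeZ]

theorem slopeZ_two (e : ℤ) : slopeZ (2, 2 * e) = e := by simp [slopeZ]

theorem mu0_two (g p : ℤ) : mu0 g p 2 = ((-(2 * g - 2 + p) : ℤ) : ℚ) := by
  rw [mu0]
  congr 1
  ring

/-- The sums over `(γ₁, [γ₂, …])` in rank two, where `P` is the strict or weak slope inequality and
`N` counts the degrees `e ≥ 0` allowed for `γ₁`. -/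
theorem finsum_rank_two (g p a : ℤ) (N : ℕ) (hg : 2 ≤ g) (hp : 0 ≤ p) (At Ht : ℤ × ℤ → RatFunc ℚ)
    (hA : ∀ e : ℤ, e < 0 → At (1, e) = 0) (P : ℚ → ℚ → Prop) [DecidableRel P]
    (hP : ∀ k : ℕ, P a ((2 * a - k : ℤ) : ℚ) ↔ k < N)
    (hN : 0 < N → 0 ≤ a) :
    (∑ᶠ t : (ℤ × ℤ) × List (ℤ × ℤ),
      if t.2 ≠ [] ∧ 1 ≤ t.1.1 ∧ (∀ x ∈ t.2, 1 ≤ x.1) ∧ t.1 + t.2.sum = (2, 2 * a) ∧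
          mu0 g p 2 ≤ slopeZ (2, 2 * a) ∧ (∀ x ∈ t.2, P (slopeZ (2, 2 * a)) (slopeZ x)) ∧
          mu0 g p 2 ≤ slopeZ t.1 then
        RatFunc.C ((-1 : ℚ) ^ t.2.length / (Nat.factorial t.2.length : ℚ)) *
          At t.1 * (t.2.map (fun x => wgt g x * Ht x)).prod
      else 0) =
    -∑ k ∈ Finset.range N,
      At (1, (k : ℤ)) * brk (2 * a - k - (g - 1)) * Ht (1, 2 * a - k) := by
  rw [finsum_eq_sum_range_rank_two _ (2 * a) N, ← Finset.sum_neg_distrib]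
  · refine Finset.sum_congr rfl fun k hk => ?_
    have hk := Finset.mem_range.1 hk
    have ha := hN (by omega)
    rw [if_pos]
    · simp [wgt, mul_assoc]
    · refine ⟨by simp, le_rfl, by simp, by simp, ?_, ?_, ?_⟩
      · rw [mu0_two, slopeZ_two]
        exact_mod_cast (by omega : -(2 * g - 2 + p) ≤ a)
      · simpa only [List.mem_singleton, forall_eq, slopeZ_one, slopeZ_two] using (hP k).2 hk
      · rw [mu0_two, slopeZ_one]
        exact_mod_cast (by omega : -(2 * g - 2 + p) ≤ k)
  · intro t ht
    rw [ne_eq, ite_eq_right_iff, Classical.not_imp] at ht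
    obtain ⟨⟨hne, h1, hr, hs, -, hsl, -⟩, hz⟩ := ht
    obtain ⟨e, rfl⟩ := rank_two_decomposition hne h1 hr hs
    obtain he | he := lt_or_ge e 0
    · simp [hA e he] at hz
    · lift e to ℕ using he
      refine ⟨e, ?_, rfl⟩
      simpa only [List.mem_singleton, forall_eq, slopeZ_one, slopeZ_two, hP] using hsl

theorem finsum_equal_slope_rank_two (g n : ℤ) (Ht : ℤ × ℤ → RatFunc ℚ) :
    (∑ᶠ L : List (ℤ × ℤ),
      if 2 ≤ L.length ∧ (∀ x ∈ L, 1 ≤ x.1) ∧ L.sum = (2, 2 * n) ∧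
          (∀ x ∈ L, slopeZ x = slopeZ (2, 2 * n)) then
        RatFunc.C (1 / (Nat.factorial L.length : ℚ)) *
          (L.map (fun x => wgt g x * Ht x)).prod
      else 0) =
    RatFunc.C (1 / 2 : ℚ) * brk (n - (g - 1)) ^ 2 * Ht (1, n) ^ 2 := by
  rw [finsum_eq_single _ [(1, n), (1, n)], if_pos]
  · simp only [List.length_cons, List.length_nil, List.map_cons, List.map_nil, List.prod_cons,
      List.prod_nil, wgt, one_mul, zero_add, Nat.reduceAdd, Nat.factorial_two, Nat.cast_ofNat]
    ring
  · simp only [slopeZ_two]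
    simp [slopeZ_one, two_mul]
  · intro L hL
    rw [if_neg]
    rintro ⟨hl, hr, hs, hsl⟩
    match L with
    | [] => simp at hl
    | x :: L =>
      rw [List.sum_cons] at hs
      have hne : L ≠ [] := by
        rintro rfl
        simp at hl
      obtain ⟨e, he⟩ := rank_two_decomposition (t := (x, L)) hne (hr x List.mem_cons_self)
        (fun y hy => hr y (List.mem_cons_of_mem _ hy)) hs
      obtain ⟨rfl, rfl⟩ := Prod.mk.inj he
      have h := hsl (1, e) List.mem_cons_self
      rw [slopeZ_one, slopeZ_two, Int.cast_inj] at h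
      subst h
      exact hL (by simp [two_mul])

/-- for `γ = (2,2n)` the general recursion right hand side `R(γ)`
reduces to the explicit rank-two even-degree formula \eqref{eq:ranktworecA}. -/
theorem stmt_13 (g p n : ℤ) (hg : 2 ≤ g) (hp : 0 ≤ p)
    (At Ht : ℤ × ℤ → RatFunc ℚ) (hA : ∀ e : ℤ, e < 0 → At (1, e) = 0) :
    Rrec g p At Ht (2, 2 * n) =
      At (2, 2 * n) - At (2, 4 * g - 4 - 2 * n)
      - (∑ k ∈ Finset.range n.toNat,
          At (1, (k : ℤ)) * brk (2 * n - k - g + 1) * Ht (1, 2 * n - k))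
      + (∑ k ∈ Finset.range (2 * g - 1 - n).toNat,
          At (1, (k : ℤ)) * brk (3 * g - 3 - 2 * n - k) * Ht (1, 4 * g - 4 - 2 * n - k))
      - RatFunc.C (1 / 2 : ℚ) * brk (n - g + 1) ^ 2 * Ht (1, n) ^ 2 := by
  have ht : tilde g (2, 2 * n) = (2, 2 * (2 * g - 2 - n)) := by
    simp only [tilde, Prod.mk.injEq, true_and]
    ring
  rw [Rrec, ht]
  dsimp only
  rw [finsum_equal_slope_rank_two,
    finsum_rank_two g p n n.toNat hg hp At Ht hA (· < ·)
      (fun k => by rw [Int.cast_lt]; omega) (by omega),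
    finsum_rank_two g p (2 * g - 2 - n) (2 * g - 1 - n).toNat hg hp At Ht hA (· ≤ ·)
      (fun k => by rw [Int.cast_le]; omega) (by omega)]
  have ha : 2 * (2 * g - 2 - n) = 4 * g - 4 - 2 * n := by ring
  have hsub (a : ℤ) : a - (g - 1) = a - g + 1 := by ring
  have hk (k : ℤ) : 4 * g - 4 - 2 * n - k - g + 1 = 3 * g - 3 - 2 * n - k := by ring
  simp only [sub_neg_eq_add, ← sub_eq_add_neg, ha, hsub, hk]

end
end

section
/- Fix integers g ≥ 2, p ≥ 0 and n ∈ ℤ, and let Ã, H̃ : ℤ_{≥1} × ℤ → ℚ(y) be arbitrary functions with Ã(1,e) = 0 for all e < 0. For γ = (2,2n+1) (so γ̃ = (2, 4g−5−2n)), define R(γ) exactly as in the general recursion: R(γ) := Ã(γ) − Ã(γ̃) + Σ_{l≥2} ((−1)^{l−1}/(l−1)!) Σ_{γ_1+⋯+γ_l=γ, μ_0(2)≤μ(γ)<μ(γ_i) for 2≤i≤l, μ_0(2)≤μ(γ_1)} Ã(γ_1) ∏_{i=2}^{l} [e_i−r_i(g−1)]_y H̃(γ_i) − Σ_{l≥2}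 ((−1)^{l−1}/(l−1)!) Σ_{γ_1+⋯+γ_l=γ̃, μ_0(2)≤μ(γ̃)≤μ(γ_i) for 2≤i≤l, μ_0(2)≤μ(γ_1)} Ã(γ_1) ∏_{i=2}^{l} [e_i−r_i(g−1)]_y H̃(γ_i) − Σ_{l≥2} (1/l!) Σ_{γ_1+⋯+γ_l=γ, μ(γ_i)=μ(γ) ∀i} ∏_{i=1}^{l} [e_i−r_i(g−1)]_y H̃(γ_i). Then R(γ) = Ã(2,2n+1) − Ã(2,4g−5−2n) − Σ_{e_1=0}^{n} Ã(1,e_1)·[2n−e_1−g+2]_y·H̃(1,2n+1−e_1) + Σ_{e_1=0}^{2g−3−n} Ã(1,e_1)·[3g−4−2n−e_1]_y·H̃(1,4g−5−2n−e_1). -/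
open scoped Classical

noncomputable section

/-- A finitely supported sum whose support lies in `{i 0, …, i (N - 1)}`, with `i` injective. -/
theorem finsum_eq_sum_range_of_injective {α M : Type*} [AddCommMonoid M] (f : α → M)
    (i : ℕ → α) (hi : Function.Injective i) (N : ℕ)
    (h : ∀ a, f a ≠ 0 → ∃ k < N, i k = a) :
    ∑ᶠ a, f a = ∑ k ∈ Finset.range N, f (i k) := by
  rw [finsum_eq_sum_of_support_subset (s := (Finset.range N).map ⟨i, hi⟩) f, Finset.sum_map]
  · rfl
  · intro a ha
    obtain ⟨k, hk, rfl⟩ := h a ha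
    simpa using ⟨k, hk, rfl⟩

theorem length_le_sum_fst (L : List (ℤ × ℤ)) (hL : ∀ x ∈ L, 1 ≤ x.1) :
    (L.length : ℤ) ≤ L.sum.1 := by
  induction L with
  | nil => simp
  | cons a L ih =>
    have h1 := hL a (by simp)
    have h2 := ih fun x hx => hL x (by simp [hx])
    simp only [List.length_cons, List.sum_cons, Prod.fst_add]
    push_cast
    omega

/-- A decomposition of a rank-two class into at least two classes of positive rank
consists of two classes of rank one. -/
theorem eq_pair_of_add_sum_eq {a : ℤ × ℤ} {L : List (ℤ × ℤ)} {d : ℤ} (hne : L ≠ [])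
    (ha : 1 ≤ a.1) (hL : ∀ x ∈ L, 1 ≤ x.1) (hs : a + L.sum = (2, d)) :
    a = (1, a.2) ∧ L = [(1, d - a.2)] := by
  have hlen := length_le_sum_fst L hL
  obtain ⟨h1, h2⟩ := Prod.ext_iff.1 hs
  simp only [Prod.fst_add, Prod.snd_add] at h1 h2
  have hpos := List.length_pos_of_ne_nil hne
  obtain ⟨b, rfl⟩ := List.length_eq_one_iff.1 (show L.length = 1 by omega)
  simp only [List.sum_singleton, List.length_singleton] at h1 h2 hlen
  have h3 : a.1 = 1 := by omega
  have h4 : b.1 = 1 := by omega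
  have h5 : b.2 = d - a.2 := by omega
  exact ⟨Prod.ext h3 rfl, by rw [← h5, ← h4]⟩

theorem half_odd_lt_slopeZ_iff (N e : ℤ) : slopeZ (2, 2 * N + 1) < slopeZ (1, e) ↔ N < e := by
  simp only [slopeZ]
  push_cast
  have h : (2 * (N : ℚ) + 1 < e * 2) ↔ 2 * N + 1 < e * 2 := by exact_mod_cast Iff.rfl
  rw [div_one, div_lt_iff₀ two_pos, h]
  omega

theorem half_odd_le_slopeZ_iff (N e : ℤ) : slopeZ (2, 2 * N + 1) ≤ slopeZ (1, e) ↔ N < e := by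
  simp only [slopeZ]
  push_cast
  have h : (2 * (N : ℚ) + 1 ≤ e * 2) ↔ 2 * N + 1 ≤ e * 2 := by exact_mod_cast Iff.rfl
  rw [div_one, div_le_iff₀ two_pos, h]
  omega

/-- The wall-crossing sum over decompositions of the class `(2, 2N+1)`, where `Q` is the slope
condition imposed on all parts but the first. -/
theorem finsum_rank_two_odd (g N : ℤ) (c : ℚ) (hc : c ≤ 0) (At Ht : ℤ × ℤ → RatFunc ℚ)
    (hA : ∀ e : ℤ, e < 0 → At (1, e) = 0) (Q : ℤ × ℤ → Prop)
    [DecidablePred Q] (hQ : ∀ e, Q (1, e) ↔ N < e) :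
    (∑ᶠ t : (ℤ × ℤ) × List (ℤ × ℤ),
      if t.2 ≠ [] ∧ 1 ≤ t.1.1 ∧ (∀ x ∈ t.2, 1 ≤ x.1) ∧ t.1 + t.2.sum = (2, 2 * N + 1) ∧
          c ≤ slopeZ (2, 2 * N + 1) ∧ (∀ x ∈ t.2, Q x) ∧ c ≤ slopeZ t.1 then
        RatFunc.C ((-1 : ℚ) ^ t.2.length / (Nat.factorial t.2.length : ℚ)) *
          At t.1 * (t.2.map (fun x => wgt g x * Ht x)).prod
      else 0) =
    - ∑ k ∈ Finset.range (N + 1).toNat,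
        At (1, (k : ℤ)) * wgt g (1, 2 * N + 1 - k) * Ht (1, 2 * N + 1 - k) := by
  rw [finsum_eq_sum_range_of_injective _
    (fun k : ℕ => ((1, (k : ℤ)), [(1, 2 * N + 1 - (k : ℤ))])) _ (N + 1).toNat,
    ← Finset.sum_neg_distrib]
  · refine Finset.sum_congr rfl fun k hk => ?_
    rw [Finset.mem_range] at hk
    have hslope : c ≤ slopeZ (2, 2 * N + 1) := by
      refine hc.trans (div_nonneg (Int.cast_nonneg ?_) (Int.cast_nonneg ?_)) <;>
        dsimp only <;> omega
    have hslope' : c ≤ slopeZ (1, (k : ℤ)) := by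
      refine hc.trans (div_nonneg (Int.cast_nonneg ?_) (Int.cast_nonneg ?_)) <;>
        dsimp only <;> omega
    rw [if_pos]
    · simp [mul_assoc]
    · refine ⟨by simp, by simp, by simp, by simp, hslope, ?_, hslope'⟩
      simp only [List.mem_singleton, forall_eq, hQ]
      omega
  · rintro ⟨⟨r, e⟩, L⟩ ht
    obtain ⟨⟨hne, hr, hL, hs, -, hLQ, -⟩, ht⟩ := ite_ne_right_iff.1 ht
    obtain ⟨h1, h2⟩ := eq_pair_of_add_sum_eq hne hr hL hs
    obtain rfl : r = 1 := congrArg Prod.fst h1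
    obtain rfl : L = [(1, 2 * N + 1 - e)] := h2
    have hlt := (hQ _).1 (hLQ (1, 2 * N + 1 - e) (by simp))
    have h0 : 0 ≤ e := by
      by_contra! h
      simp [hA e h] at ht
    lift e to ℕ using h0
    exact ⟨e, by omega, rfl⟩
  · intro a b hab
    simpa using congrArg (fun t => t.1.2) hab

/-- for `γ = (2,2n+1)` the general recursion right hand side `R(γ)`
reduces to the explicit rank-two odd-degree formula \eqref{eq:ranktworecB}. -/
theorem stmt_14 (g p n : ℤ) (hg : 2 ≤ g) (hp : 0 ≤ p)
    (At Ht : ℤ × ℤ → RatFunc ℚ) (hA : ∀ e : ℤ, e < 0 → At (1, e) = 0) :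
    Rrec g p At Ht (2, 2 * n + 1) =
      At (2, 2 * n + 1) - At (2, 4 * g - 5 - 2 * n)
      - (∑ k ∈ Finset.range (n + 1).toNat,
          At (1, (k : ℤ)) * brk (2 * n - k - g + 2) * Ht (1, 2 * n + 1 - k))
      + (∑ k ∈ Finset.range (2 * g - 2 - n).toNat,
          At (1, (k : ℤ)) * brk (3 * g - 4 - 2 * n - k) *
            Ht (1, 4 * g - 5 - 2 * n - k)) := by
  have hc : mu0 g p 2 ≤ 0 := by
    rw [mu0, Int.cast_nonpos]
    linarith
  have ht : tilde g (2, 2 * n + 1) = (2, 2 * (2 * g - 3 - n) + 1) :=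
    Prod.ext rfl (by simp only [tilde]; ring)
  have hsemi : (∑ᶠ L : List (ℤ × ℤ),
      if 2 ≤ L.length ∧ (∀ x ∈ L, 1 ≤ x.1) ∧ L.sum = (2, 2 * n + 1) ∧
          (∀ x ∈ L, slopeZ x = slopeZ (2, 2 * n + 1)) then
        RatFunc.C (1 / (Nat.factorial L.length : ℚ)) *
          (L.map (fun x => wgt g x * Ht x)).prod
      else 0) = 0 := by
    refine finsum_eq_zero_of_forall_eq_zero fun L => if_neg ?_
    rintro ⟨hlen, hL, hs, hslope⟩
    rcases L with - | ⟨a, L⟩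
    · simp at hlen
    have hne : L ≠ [] := by
      rintro rfl
      simp at hlen
    obtain ⟨h1, -⟩ := eq_pair_of_add_sum_eq hne (hL a (by simp))
      (fun x hx => hL x (by simp [hx])) (by simpa using hs)
    have hs1 := hslope a (by simp)
    rw [h1] at hs1
    exact ((half_odd_lt_slopeZ_iff n a.2).2 ((half_odd_le_slopeZ_iff n a.2).1 hs1.ge)).ne' hs1
  have hpos := finsum_rank_two_odd g n _ hc At Ht hA
    (slopeZ (2, 2 * n + 1) < slopeZ ·) (half_odd_lt_slopeZ_iff n)
  have hneg := finsum_rank_two_odd g (2 * g - 3 - n) _ hc At Ht hA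
    (slopeZ (2, 2 * (2 * g - 3 - n) + 1) ≤ slopeZ ·) (half_odd_le_slopeZ_iff (2 * g - 3 - n))
  rw [Rrec, ht]
  dsimp only
  rw [hsemi, hpos, hneg]
  have h1 : 2 * (2 * g - 3 - n) + 1 = 4 * g - 5 - 2 * n := by ring
  have h2 : 2 * g - 3 - n + 1 = 2 * g - 2 - n := by ring
  have h3 (k : ℤ) : wgt g (1, 2 * n + 1 - k) = brk (2 * n - k - g + 2) := by
    rw [wgt]; congr 1; ring
  have h4 (k : ℤ) : wgt g (1, 4 * g - 5 - 2 * n - k) = brk (3 * g - 4 - 2 * n - k) := by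
    rw [wgt]; congr 1; ring
  simp only [h1, h2, h3, h4]
  ring

end
end

section
/- Fix integers g ≥ 2, p ≥ 0 and n ∈ ℤ, and let Ã, H̃ : ℤ_{≥1} × ℤ → ℚ(y) be arbitrary functions with Ã(1,e) = 0 for all e < 0 and Ã(2,e) = 0 for all e < 2−2g−p. For γ = (3,3n+1) (so γ̃ = (3, 6g−7−3n)), define R(γ) as in the general recursion: R(γ) := Ã(γ) − Ã(γ̃) + Σ_{l≥2} ((−1)^{l−1}/(l−1)!) Σ_{γ_1+⋯+γ_l=γ, μ_0(3)≤μ(γ)<μ(γ_i) for 2≤i≤l, μ_0(3)≤μ(γ_1)} Ã(γ_1) ∏_{i=2}^{l} [e_i−r_i(g−1)]_y H̃(γ_i) − Σ_{l≥2} ((−1)^{l−1}/(l−1)!) Σ_{γ_1+⋯+γ_l=γ̃, μ_0(3)≤μ(γ̃)≤μ(γ_i) for 2≤i≤l, μ_0(3)≤μ(γ_1)} Ã(γ_1) ∏_{i=2}^{l} [e_i−r_i(g−1)]_y H̃(γ_i) − Σ_{l≥2} (1/l!) Σ_{γ_1+⋯+γ_l=γ, μ(γ_i)=μ(γ) ∀i}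 ∏_{i=1}^{l} [e_i−r_i(g−1)]_y H̃(γ_i). Then R(γ) = Ã(3,3n+1) − Ã(3,6g−7−3n) − Σ_{e_1=2−2g−p}^{2n} Ã(2,e_1)[3n+2−g−e_1]_y H̃(1,3n+1−e_1) − Σ_{e_1=0}^{n} Ã(1,e_1)[3n+3−2g−e_1]_y H̃(2,3n+1−e_1) + (1/2) Σ_{e_1=0}^{n−1} Σ_{e_2=n+1}^{2n−e_1} Ã(1,e_1)[e_2−g+1]_y[3n+2−g−e_1−e_2]_y H̃(1,e_2) H̃(1,3n+1−e_1−e_2) + Σ_{e_1=2−2g−p}^{4g−2n−5} Ã(2,e_1)[5g−6−3n−e_1]_y H̃(1,6g−7−3n−e_1) + Σ_{e_1=0}^{2g−n−3} Ã(1,e_1)[4g−5−3n−e_1]_y H̃(2,6g−7−3n−e_1) − (1/2) Σ_{e_1=0}^{2g−3−n} Σ_{e_2=2g−2−n}^{4g−2n−5−e_1} Ã(1,e_1)[e_2−g+1]_y[5g−6−3n−e_1−e_2]_y H̃(1,e_2) H̃(1,6g−7−3n−e_1−e_2). -/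
open scoped Classical

noncomputable section

/-- An ordered tuple of elements of positive rank with total rank `3` and at least two entries,
written as a head and a nonempty tail, has rank pattern `(2,1)`, `(1,2)` or `(1,1,1)`. -/
lemma rank_three_tuple_cases {N : ℤ} {t : (ℤ × ℤ) × List (ℤ × ℤ)} (hne : t.2 ≠ [])
    (h1 : 1 ≤ t.1.1) (hpos : ∀ x ∈ t.2, 1 ≤ x.1) (hsum : t.1 + t.2.sum = (3, N)) :
    (∃ e, t = ((2, e), [(1, N - e)])) ∨ (∃ e, t = ((1, e), [(2, N - e)])) ∨
      ∃ e f, t = ((1, e), [(1, f), (1, N - e - f)]) := by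
  have list_sum_nonneg : ∀ L : List (ℤ × ℤ), (∀ x ∈ L, 1 ≤ x.1) → 0 ≤ L.sum.1 := by
    intro L
    induction L with
    | nil => simp
    | cons x L ih =>
      intro h
      have hx := h x (by simp)
      have hL := ih fun z hz => h z (by simp [hz])
      simp only [List.sum_cons, Prod.fst_add]
      omega
  obtain ⟨⟨r, e⟩, L⟩ := t
  match L with
  | [] => exact absurd rfl hne
  | [(r₂, e₂)] =>
    have h2 : 1 ≤ r₂ := hpos (r₂, e₂) (by simp)
    simp only [List.sum_cons, List.sum_nil, add_zero, Prod.mk_add_mk, Prod.mk.injEq] at hsum h1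
    obtain ⟨hr, he⟩ := hsum
    obtain rfl : e₂ = N - e := by omega
    obtain ⟨rfl, rfl⟩ | ⟨rfl, rfl⟩ : (r = 2 ∧ r₂ = 1) ∨ (r = 1 ∧ r₂ = 2) := by omega
    · exact Or.inl ⟨e, rfl⟩
    · exact Or.inr (Or.inl ⟨e, rfl⟩)
  | [(r₂, e₂), (r₃, e₃)] =>
    have h2 : 1 ≤ r₂ := hpos (r₂, e₂) (by simp)
    have h3 : 1 ≤ r₃ := hpos (r₃, e₃) (by simp)
    simp only [List.sum_cons, List.sum_nil, add_zero, Prod.mk_add_mk, Prod.mk.injEq] at hsum h1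
    obtain ⟨hr, he⟩ := hsum
    obtain rfl : e₃ = N - e - e₂ := by omega
    obtain ⟨rfl, rfl, rfl⟩ : r = 1 ∧ r₂ = 1 ∧ r₃ = 1 := by omega
    exact Or.inr (Or.inr ⟨e, e₂, rfl⟩)
  | (r₂, e₂) :: (r₃, e₃) :: (r₄, e₄) :: L =>
    have h2 : 1 ≤ r₂ := hpos (r₂, e₂) (by simp)
    have h3 : 1 ≤ r₃ := hpos (r₃, e₃) (by simp)
    have h4 : 1 ≤ r₄ := hpos (r₄, e₄) (by simp)
    have hL := list_sum_nonneg L fun z hz => hpos z (by simp [hz])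
    have := congrArg Prod.fst hsum
    simp only [List.sum_cons, Prod.fst_add] at this h1
    omega

open Finset in
/-- Evaluation of a sum over ordered tuples `(γ₁, …, γ_l)`, `l ≥ 2`, of total class `(3, N)`, whose
tail entries of rank `1` and `2` have degree bounded below by `a` and `b`. -/
lemma finsum_rank_three (g lo N a b : ℤ) (At Ht : ℤ × ℤ → RatFunc ℚ)
    (hA1 : ∀ e : ℤ, e < 0 → At (1, e) = 0) (hA2 : ∀ e : ℤ, e < lo → At (2, e) = 0)
    (P M : ℤ × ℤ → Prop) (Q : Prop)
    (hP1 : ∀ e, P (1, e) ↔ a ≤ e) (hP2 : ∀ e, P (2, e) ↔ b ≤ e)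
    (hM1 : ∀ e, 0 ≤ e → M (1, e)) (hM2 : ∀ e, lo ≤ e → M (2, e))
    (hQ : ¬ Q → N - a < lo ∧ N - b < 0 ∧ N - 2 * a < 0)
    (F : (ℤ × ℤ) × List (ℤ × ℤ) → RatFunc ℚ)
    (hF : ∀ t, (t.2 ≠ [] ∧ 1 ≤ t.1.1 ∧ (∀ x ∈ t.2, 1 ≤ x.1) ∧ t.1 + t.2.sum = (3, N) ∧
        Q ∧ (∀ x ∈ t.2, P x) ∧ M t.1) →
      F t = RatFunc.C ((-1 : ℚ) ^ t.2.length / (Nat.factorial t.2.length : ℚ)) *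
          At t.1 * (t.2.map (fun x => wgt g x * Ht x)).prod)
    (hF0 : ∀ t, ¬ (t.2 ≠ [] ∧ 1 ≤ t.1.1 ∧ (∀ x ∈ t.2, 1 ≤ x.1) ∧ t.1 + t.2.sum = (3, N) ∧
        Q ∧ (∀ x ∈ t.2, P x) ∧ M t.1) → F t = 0) :
    ∑ᶠ t, F t =
      - (∑ k ∈ range (N - a - lo + 1).toNat,
          At (2, lo + k) * wgt g (1, N - (lo + k)) * Ht (1, N - (lo + k)))
      - (∑ k ∈ range (N - b + 1).toNat,
          At (1, (k : ℤ)) * wgt g (2, N - k) * Ht (2, N - k))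
      + RatFunc.C (1 / 2 : ℚ) *
        ∑ k₁ ∈ range (N - 2 * a + 1).toNat, ∑ k₂ ∈ range (N - 2 * a + 1 - k₁).toNat,
          At (1, (k₁ : ℤ)) * wgt g (1, a + k₂) * wgt g (1, N - k₁ - (a + k₂)) *
            Ht (1, a + k₂) * Ht (1, N - k₁ - (a + k₂)) := by
  let i₁ : ℕ → (ℤ × ℤ) × List (ℤ × ℤ) := fun k => ((2, lo + k), [(1, N - (lo + k))])
  let i₂ : ℕ → (ℤ × ℤ) × List (ℤ × ℤ) := fun k => ((1, (k : ℤ)), [(2, N - k)])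
  let i₃ : (_ : ℕ) × ℕ → (ℤ × ℤ) × List (ℤ × ℤ) :=
    fun k => ((1, (k.1 : ℤ)), [(1, a + k.2), (1, N - k.1 - (a + k.2))])
  have hi₁ : Function.Injective i₁ := fun k l h => by
    simp only [i₁, Prod.mk.injEq] at h; omega
  have hi₂ : Function.Injective i₂ := fun k l h => by
    simp only [i₂, Prod.mk.injEq] at h; omega
  have hi₃ : Function.Injective i₃ := by
    rintro ⟨k, k'⟩ ⟨l, l'⟩ h
    simp only [i₃, Prod.mk.injEq, List.cons.injEq] at h
    obtain rfl : k = l := by omega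
    obtain rfl : k' = l' := by omega
    rfl
  let S₁ := (range (N - a - lo + 1).toNat).image i₁
  let S₂ := (range (N - b + 1).toNat).image i₂
  let S₃ := ((range (N - 2 * a + 1).toNat).sigma
    fun k₁ => range (N - 2 * a + 1 - k₁).toNat).image i₃
  have hsupp : Function.support F ⊆ ↑((S₁ ∪ S₂) ∪ S₃) := by
    intro t ht
    by_cases hC : (t.2 ≠ [] ∧ 1 ≤ t.1.1 ∧ (∀ x ∈ t.2, 1 ≤ x.1) ∧ t.1 + t.2.sum = (3, N) ∧
        Q ∧ (∀ x ∈ t.2, P x) ∧ M t.1)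
    · have hval := hF t hC
      have hA : At t.1 ≠ 0 := fun h => ht (by rw [hval, h]; simp)
      obtain ⟨hne, h1, hpos, hsum, -, hP, -⟩ := hC
      simp only [coe_union, Set.mem_union, mem_coe]
      obtain ⟨e, rfl⟩ | ⟨e, rfl⟩ | ⟨e, f, rfl⟩ := rank_three_tuple_cases hne h1 hpos hsum
      · have he : lo ≤ e := by
          by_contra! h
          exact hA (hA2 e h)
        have hP' := (hP1 _).1 (hP (1, N - e) (by simp))
        refine Or.inl (Or.inl (mem_image.2 ⟨(e - lo).toNat, mem_range.2 (by omega), ?_⟩))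
        have : lo + ((e - lo).toNat : ℤ) = e := by omega
        simp only [i₁, this]
      · have he : 0 ≤ e := by
          by_contra! h
          exact hA (hA1 e h)
        have hP' := (hP2 _).1 (hP (2, N - e) (by simp))
        refine Or.inl (Or.inr (mem_image.2 ⟨e.toNat, mem_range.2 (by omega), ?_⟩))
        have : (e.toNat : ℤ) = e := by omega
        simp only [i₂, this]
      · have he : 0 ≤ e := by
          by_contra! h
          exact hA (hA1 e h)
        have hP' := (hP1 _).1 (hP (1, f) (by simp))
        have hP'' := (hP1 _).1 (hP (1, N - e - f) (by simp))
        refine Or.inr (mem_image.2 ⟨⟨e.toNat, (f - a).toNat⟩, ?_, ?_⟩)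
        · simp only [mem_sigma, mem_range]
          omega
        · have h₁ : (e.toNat : ℤ) = e := by omega
          have h₂ : a + ((f - a).toNat : ℤ) = f := by omega
          simp only [i₃, h₁, h₂]
    · exact absurd (hF0 t hC) ht
  have hd₁ : Disjoint S₁ S₂ := by
    rw [disjoint_left]
    intro t h h'
    obtain ⟨k, -, rfl⟩ := mem_image.1 h
    obtain ⟨l, -, h'⟩ := mem_image.1 h'
    simp [i₁, i₂] at h'
  have hd₂ : Disjoint (S₁ ∪ S₂) S₃ := by
    rw [disjoint_left]
    intro t h h'
    obtain ⟨l, -, rfl⟩ := mem_image.1 h'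
    obtain h | h := mem_union.1 h
    · obtain ⟨k, -, h⟩ := mem_image.1 h
      simp [i₁, i₃] at h
    · obtain ⟨k, -, h⟩ := mem_image.1 h
      simp [i₂, i₃] at h
  rw [finsum_eq_sum_of_support_subset F hsupp, sum_union hd₂, sum_union hd₁,
    sum_image hi₁.injOn, sum_image hi₂.injOn, sum_image hi₃.injOn, sum_sigma,
    ← sum_neg_distrib, sub_eq_add_neg (G := RatFunc ℚ), ← sum_neg_distrib, mul_sum]
  congr 1
  · congr 1
    · refine sum_congr rfl fun k hk => ?_
      rw [mem_range] at hk
      have hQ' : Q := by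
        by_contra h
        have := hQ h
        omega
      rw [hF (i₁ k)]
      · simp [i₁, mul_assoc]
      · simp only [i₁, List.mem_singleton, forall_eq, List.sum_singleton, hP1, hQ',
          hM2 (lo + k) (by omega)]
        simp
        omega
    · refine sum_congr rfl fun k hk => ?_
      rw [mem_range] at hk
      have hQ' : Q := by
        by_contra h
        have := hQ h
        omega
      rw [hF (i₂ k)]
      · simp [i₂, mul_assoc]
      · simp only [i₂, List.mem_singleton, forall_eq, List.sum_singleton, hP2, hQ',
          hM1 k (by omega)]
        simp
        omega
  · refine sum_congr rfl fun k₁ hk₁ => ?_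
    rw [mul_sum]
    refine sum_congr rfl fun k₂ hk₂ => ?_
    rw [mem_range] at hk₁ hk₂
    have hQ' : Q := by
      by_contra h
      have := hQ h
      omega
    rw [hF (i₃ ⟨k₁, k₂⟩)]
    · simp [i₃]
      ring
    · simp only [i₃, hQ', hM1 k₁ (by omega)]
      simp [hP1]
      omega

/-- A tuple of at least two classes with sum `(3, 3n+1)` does not have constant slope. -/
lemma not_equal_slope_rank_three (n : ℤ) (L : List (ℤ × ℤ)) :
    ¬ (2 ≤ L.length ∧ (∀ x ∈ L, 1 ≤ x.1) ∧ L.sum = (3, 3 * n + 1) ∧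
      ∀ x ∈ L, slopeZ x = slopeZ (3, 3 * n + 1)) := by
  rintro ⟨hl, hpos, hsum, hs⟩
  obtain _ | ⟨x, L⟩ := L
  · simp at hl
  have hne : L ≠ [] := by
    rintro rfl
    simp at hl
  have hx := hs x (by simp)
  rw [List.sum_cons] at hsum
  have key : ∀ r e : ℤ, (r = 1 ∨ r = 2) → slopeZ (r, e) ≠ slopeZ (3, 3 * n + 1) := by
    intro r e hr h
    have hr0 : (r : ℚ) ≠ 0 := by
      rcases hr with rfl | rfl <;> norm_num
    simp only [slopeZ] at h
    rw [div_eq_div_iff hr0 (by norm_num)] at h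
    have h' : e * 3 = (3 * n + 1) * r := by exact_mod_cast h
    rcases hr with rfl | rfl <;> omega
  obtain ⟨e, h⟩ | ⟨e, h⟩ | ⟨e, f, h⟩ := rank_three_tuple_cases (t := (x, L)) hne
      (hpos x (by simp)) (fun z hz => hpos z (by simp [hz])) hsum <;>
  · obtain rfl := congrArg Prod.fst h
    exact key _ _ (by simp) hx

/-- for `γ = (3,3n+1)` the general recursion right hand side `R(γ)`
reduces to the explicit rank-three formula \eqref{eq:rankthreerecA}.  Here
`lo = 2-2g-p` and a sum `Σ_{e₁=a}^{b}` is written as a sum over `k ∈ range` with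
`e₁ = a + k`. -/
theorem stmt_15 (g p n : ℤ) (hg : 2 ≤ g) (hp : 0 ≤ p)
    (At Ht : ℤ × ℤ → RatFunc ℚ)
    (hA1 : ∀ e : ℤ, e < 0 → At (1, e) = 0)
    (hA2 : ∀ e : ℤ, e < 2 - 2 * g - p → At (2, e) = 0) :
    Rrec g p At Ht (3, 3 * n + 1) =
      At (3, 3 * n + 1) - At (3, 6 * g - 7 - 3 * n)
      - (∑ k ∈ Finset.range ((2 * n - (2 - 2 * g - p) + 1).toNat),
          At (2, 2 - 2 * g - p + k) * brk (3 * n + 2 - g - (2 - 2 * g - p + k)) *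
            Ht (1, 3 * n + 1 - (2 - 2 * g - p + k)))
      - (∑ k ∈ Finset.range ((n + 1).toNat),
          At (1, (k : ℤ)) * brk (3 * n + 3 - 2 * g - k) * Ht (2, 3 * n + 1 - k))
      + RatFunc.C (1 / 2 : ℚ) *
          (∑ k₁ ∈ Finset.range n.toNat, ∑ k₂ ∈ Finset.range ((n - k₁).toNat),
            At (1, (k₁ : ℤ)) * brk ((n + 1 + k₂) - g + 1) *
              brk (3 * n + 2 - g - k₁ - (n + 1 + k₂)) *
              Ht (1, n + 1 + k₂) * Ht (1, 3 * n + 1 - k₁ - (n + 1 + k₂)))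
      + (∑ k ∈ Finset.range ((4 * g - 2 * n - 4 - (2 - 2 * g - p)).toNat),
          At (2, 2 - 2 * g - p + k) * brk (5 * g - 6 - 3 * n - (2 - 2 * g - p + k)) *
            Ht (1, 6 * g - 7 - 3 * n - (2 - 2 * g - p + k)))
      + (∑ k ∈ Finset.range ((2 * g - n - 2).toNat),
          At (1, (k : ℤ)) * brk (4 * g - 5 - 3 * n - k) * Ht (2, 6 * g - 7 - 3 * n - k))
      - RatFunc.C (1 / 2 : ℚ) *
          (∑ k₁ ∈ Finset.range ((2 * g - 2 - n).toNat),
            ∑ k₂ ∈ Finset.range ((2 * g - n - 2 - k₁).toNat),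
              At (1, (k₁ : ℤ)) * brk ((2 * g - 2 - n + k₂) - g + 1) *
                brk (5 * g - 6 - 3 * n - k₁ - (2 * g - 2 - n + k₂)) *
                Ht (1, 2 * g - 2 - n + k₂) *
                Ht (1, 6 * g - 7 - 3 * n - k₁ - (2 * g - 2 - n + k₂))) := by
  have hpos : 0 < 2 * g - 2 + p := by omega
  have hM1 : ∀ e : ℤ, 0 ≤ e → mu0 g p 3 ≤ slopeZ (1, e) := by
    intro e he
    simp only [mu0, slopeZ, Int.cast_one, div_one]
    exact_mod_cast (by omega : -(3 - 1) * (2 * g - 2 + p) ≤ e)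
  have hM2 : ∀ e : ℤ, 2 - 2 * g - p ≤ e → mu0 g p 3 ≤ slopeZ (2, e) := by
    intro e he
    simp only [mu0, slopeZ]
    rw [le_div_iff₀ (by norm_num)]
    exact_mod_cast (by omega : -(3 - 1) * (2 * g - 2 + p) * 2 ≤ e)
  have hQ3 : ∀ N : ℤ, ¬ mu0 g p 3 ≤ slopeZ (3, N) → N < -6 * (2 * g - 2 + p) := by
    intro N h
    simp only [mu0, slopeZ] at h
    rw [not_le, div_lt_iff₀ (by norm_num)] at h
    have h' : N < -(3 - 1) * (2 * g - 2 + p) * 3 := by exact_mod_cast h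
    omega
  have htilde : tilde g (3, 3 * n + 1) = (3, 6 * g - 7 - 3 * n) := by
    simp only [tilde, Prod.mk.injEq, true_and]
    ring
  unfold Rrec
  rw [htilde,
    finsum_rank_three g (2 - 2 * g - p) (3 * n + 1) (n + 1) (2 * n + 1) At Ht hA1 hA2
      (fun x => slopeZ (3, 3 * n + 1) < slopeZ x) (fun x => mu0 g p 3 ≤ slopeZ x)
      (mu0 g p 3 ≤ slopeZ (3, 3 * n + 1)) ?_ ?_ hM1 hM2 ?_ _
      (fun t h => if_pos h) (fun t h => if_neg h),
    finsum_rank_three g (2 - 2 * g - p) (6 * g - 7 - 3 * n) (2 * g - 2 - n)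
      (2 * (2 * g - 2 - n)) At Ht hA1 hA2
      (fun x => slopeZ (3, 6 * g - 7 - 3 * n) ≤ slopeZ x) (fun x => mu0 g p 3 ≤ slopeZ x)
      (mu0 g p 3 ≤ slopeZ (3, 6 * g - 7 - 3 * n)) ?_ ?_ hM1 hM2 ?_ _
      (fun t h => if_pos h) (fun t h => if_neg h),
    finsum_eq_zero_of_forall_eq_zero
      (fun L => if_neg (not_equal_slope_rank_three n L))]
  · have e₁ : 3 * n + 1 - (n + 1) - (2 - 2 * g - p) + 1 = 2 * n - (2 - 2 * g - p) + 1 := by ring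
    have e₂ : 3 * n + 1 - (2 * n + 1) + 1 = n + 1 := by ring
    have e₃ : 3 * n + 1 - 2 * (n + 1) + 1 = n := by ring
    have e₄ : 6 * g - 7 - 3 * n - (2 * g - 2 - n) - (2 - 2 * g - p) + 1
      = 4 * g - 2 * n - 4 - (2 - 2 * g - p) := by ring
    have e₅ : 6 * g - 7 - 3 * n - 2 * (2 * g - 2 - n) + 1 = 2 * g - n - 2 := by ring
    have e₆ : 2 * g - 2 - n = 2 * g - n - 2 := by ring
    have w₁ : ∀ e, wgt g (1, e) = brk (e - g + 1) := fun e => by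
      simp only [wgt]; congr 1; ring
    have w₂ : ∀ e, wgt g (2, e) = brk (e - 2 * g + 2) := fun e => by
      simp only [wgt]; congr 1; ring
    have b₁ : ∀ e, 3 * n + 1 - e - g + 1 = 3 * n + 2 - g - e := fun e => by ring
    have b₂ : ∀ e, 3 * n + 1 - e - 2 * g + 2 = 3 * n + 3 - 2 * g - e := fun e => by ring
    have b₃ : ∀ e f, 3 * n + 1 - e - f - g + 1 = 3 * n + 2 - g - e - f := fun e f => by ring
    have b₄ : ∀ e, 6 * g - 7 - 3 * n - e - g + 1 = 5 * g - 6 - 3 * n - e := fun e => by ring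
    have b₅ : ∀ e, 6 * g - 7 - 3 * n - e - 2 * g + 2 = 4 * g - 5 - 3 * n - e := fun e => by ring
    have b₆ : ∀ e f, 6 * g - 7 - 3 * n - e - f - g + 1 = 5 * g - 6 - 3 * n - e - f :=
      fun e f => by ring
    simp only [w₁, w₂, e₁, e₂, e₃, e₄, e₅, b₁, b₂, b₃, b₄, b₅, b₆]
    rw [show (2 * g - 2 - n).toNat = (2 * g - n - 2).toNat by rw [e₆]]
    ring
  · intro e
    simp only [slopeZ, Int.cast_one, div_one]
    rw [div_le_iff₀ (by norm_num)]
    norm_cast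
    omega
  · intro e
    simp only [slopeZ]
    rw [div_le_div_iff₀ (by norm_num) (by norm_num)]
    norm_cast
    omega
  · intro h
    have := hQ3 _ h
    omega
  · intro e
    simp only [slopeZ, Int.cast_one, div_one]
    rw [div_lt_iff₀ (by norm_num)]
    norm_cast
    omega
  · intro e
    simp only [slopeZ]
    rw [div_lt_div_iff₀ (by norm_num) (by norm_num)]
    norm_cast
    omega
  · intro h
    have := hQ3 _ h
    omega

end
end
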